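/- Let E^s be the standard Courant algebroid determined by a quintuple (F,𝒢;∇,R,ℋ) satisfying conditions (i)-(v), with ample Lie algebroid the standard quadratic Lie algebroid 𝒜^s determined by (F,𝒢;∇,R), and let C^s be the 3-form C^s(r+x,s+y,t+z) = ℋ(x,y,z) − ⟨[r,s]_𝒢,t⟩_𝒢 + ⟨R(x,y),t⟩_𝒢 + ⟨R(y,z),r⟩_𝒢 + ⟨R(z,x),s⟩_𝒢 on 𝒜^s. Then the characteristic class of E^s equals [C^s] ∈ H³(𝒜^s), under the identification of the naive cohomology of E^s with the Lie algebroid cohomology of 𝒜^s. -/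

import Mathlib

/-! # Statement 13
For the standard Courant algebroid `E^s` determined by a quintuple `(F,𝒢;∇,R,ℋ)`,
the characteristic class (the naive cohomology class of the 3-cocycle `C_Ψ` induced by
any dissection `Ψ`) equals `[C^s]`, under the identification of the naive cohomology
of `E^s` with the Lie algebroid cohomology of `𝒜^s`.

Algebraic model: `A` plays the role of `C^∞(M)`, vector fields are
`Derivation ℝ A A`, `F` is a bracket-closed `A`-submodule of `Derivation ℝ A A`. -/

/-- A Courant algebroid (in algebraic form). -/
structure CourantAlgebroid (A : Type) [CommRing A] [Algebra ℝ A]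
    (E : Type) [AddCommGroup E] [Module A E] [Module ℝ E] [IsScalarTower ℝ A E] where
  /-- the pseudo-metric `⟨-,-⟩` -/
  ip : E →ₗ[A] E →ₗ[A] A
  /-- the anchor `ρ` -/
  rho : E →ₗ[A] Derivation ℝ A A
  /-- the Dorfman bracket `∘` (ℝ-bilinear) -/
  dorf : E →ₗ[ℝ] E →ₗ[ℝ] E
  /-- the map `𝒟 : C^∞(M) → Γ(E)` -/
  Dmap : A → E
  ip_symm : ∀ e₁ e₂, ip e₁ e₂ = ip e₂ e₁
  /-- fiberwise nondegeneracy of the pseudo-metric: `Ξ : E → E*` is bijective -/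
  ip_nondeg : Function.Bijective fun e => ip e
  /-- `⟨𝒟f, e⟩ = ½ ρ(e) f` -/
  ip_D : ∀ (f : A) (e : E), (2 : A) * ip (Dmap f) e = rho e f
  /-- `ρ ∘ 𝒟 = 0` -/
  rho_D : ∀ f : A, rho (Dmap f) = 0
  dorf_jacobi : ∀ e₁ e₂ e₃,
    dorf e₁ (dorf e₂ e₃) = dorf (dorf e₁ e₂) e₃ + dorf e₂ (dorf e₁ e₃)
  rho_dorf : ∀ e₁ e₂, rho (dorf e₁ e₂) = ⁅rho e₁, rho e₂⁆
  dorf_leibniz : ∀ (e₁ : E) (f : A) (e₂ : E),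
    dorf e₁ (f • e₂) = rho e₁ f • e₂ + f • dorf e₁ e₂
  dorf_sym : ∀ e₁ e₂, dorf e₁ e₂ + dorf e₂ e₁ = (2 : ℝ) • Dmap (ip e₁ e₂)
  dorf_D : ∀ (f : A) (e : E), dorf (Dmap f) e = 0
  rho_ip : ∀ e₁ e₂ e₃,
    rho e₁ (ip e₂ e₃) = ip (dorf e₁ e₂) e₃ + ip e₂ (dorf e₁ e₃)

namespace CourantAlgebroid

variable {A : Type} [CommRing A] [Algebra ℝ A]
variable {E : Type} [AddCommGroup E] [Module A E] [Module ℝ E] [IsScalarTower ℝ A E]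
variable (ca : CourantAlgebroid A E)

/-- `(ker ρ)⊥`, the subbundle of `E` orthogonal to `ker ρ` w.r.t. the pseudo-metric. -/
def perp : Submodule A E where
  carrier := {e | ∀ k ∈ LinearMap.ker ca.rho, ca.ip e k = 0}
  add_mem' := by
    intro a b ha hb k hk
    simp [map_add, ha k hk, hb k hk]
  zero_mem' := by intro k hk; simp
  smul_mem' := by
    intro c x hx k hk
    simp [map_smul, hx k hk]

/-- Regularity (constant rank of the anchor), expressed by the splitting of the two
canonical short exact sequences `0 → ker ρ → E → F → 0` and
`0 → (ker ρ)⊥ → ker ρ → 𝒢 → 0`. -/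
def IsRegular : Prop :=
  (∃ lam : ↥(LinearMap.range ca.rho) →ₗ[A] E, ∀ x, ca.rho (lam x) = ↑x) ∧
  (∃ sig : (↥(LinearMap.ker ca.rho) ⧸
        (ca.perp.comap (LinearMap.ker ca.rho).subtype)) →ₗ[A] ↥(LinearMap.ker ca.rho),
      ∀ g, (ca.perp.comap (LinearMap.ker ca.rho).subtype).mkQ (sig g) = g)

lemma dorf_mem_ker {r s : E} (hr : r ∈ LinearMap.ker ca.rho)
    (hs : s ∈ LinearMap.ker ca.rho) : ca.dorf r s ∈ LinearMap.ker ca.rho := by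
  rw [LinearMap.mem_ker] at *
  rw [ca.rho_dorf, hr, hs, zero_lie]

lemma dorf_ker_left_mem_ker (e : E) {r : E} (hr : r ∈ LinearMap.ker ca.rho) :
    ca.dorf e r ∈ LinearMap.ker ca.rho := by
  rw [LinearMap.mem_ker] at *
  rw [ca.rho_dorf, hr, lie_zero]

/-- sections of `ker ρ` -/
abbrev Ker := ↥(LinearMap.ker ca.rho)

/-- `(ker ρ)⊥` viewed inside `ker ρ` -/
abbrev perp' : Submodule A ca.Ker := ca.perp.comap (LinearMap.ker ca.rho).subtype

/-- `𝒢 := ker ρ/(ker ρ)⊥` -/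
abbrev Gq := ca.Ker ⧸ ca.perp'

/-- the projection `π : ker ρ → 𝒢` -/
abbrev piG : ca.Ker →ₗ[A] ca.Gq := ca.perp'.mkQ

/-- the ample quotient `𝒜_E := E/(ker ρ)⊥` -/
abbrev Ample := E ⧸ ca.perp

/-- the projection `q : E → 𝒜_E` -/
abbrev qA : E →ₗ[A] ca.Ample := ca.perp.mkQ

/-- Dorfman bracket of two sections of `ker ρ`, viewed in `ker ρ`. -/
def dorfK (r s : ca.Ker) : ca.Ker := ⟨ca.dorf ↑r ↑s, ca.dorf_mem_ker r.2 s.2⟩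

/-- Dorfman bracket of a section of `E` with a section of `ker ρ`, viewed in `ker ρ`. -/
def dorfEK (e : E) (r : ca.Ker) : ca.Ker := ⟨ca.dorf e ↑r, ca.dorf_ker_left_mem_ker e r.2⟩

end CourantAlgebroid

section CE
variable {V A : Type} [CommRing A]

/-- differential of a `1`-form -/
def dCE1 (act : V → A → A) (bk : V → V → V) (ω : V → A) (x₀ x₁ : V) : A :=
  act x₀ (ω x₁) - act x₁ (ω x₀) - ω (bk x₀ x₁)

/-- differential of a `2`-form -/
def dCE2 (act : V → A → A) (bk : V → V → V) (ω : V → V → A) (x₀ x₁ x₂ : V) : A :=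
  act x₀ (ω x₁ x₂) - act x₁ (ω x₀ x₂) + act x₂ (ω x₀ x₁)
    - ω (bk x₀ x₁) x₂ + ω (bk x₀ x₂) x₁ - ω (bk x₁ x₂) x₀

/-- differential of a `3`-form -/
def dCE3 (act : V → A → A) (bk : V → V → V) (ω : V → V → V → A)
    (x₀ x₁ x₂ x₃ : V) : A :=
  act x₀ (ω x₁ x₂ x₃) - act x₁ (ω x₀ x₂ x₃) + act x₂ (ω x₀ x₁ x₃)
    - act x₃ (ω x₀ x₁ x₂)
    - ω (bk x₀ x₁) x₂ x₃ + ω (bk x₀ x₂) x₁ x₃ - ω (bk x₀ x₃) x₁ x₂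
    - ω (bk x₁ x₂) x₀ x₃ + ω (bk x₁ x₃) x₀ x₂ - ω (bk x₂ x₃) x₀ x₁

/-- differential of a `4`-form -/
def dCE4 (act : V → A → A) (bk : V → V → V) (ω : V → V → V → V → A)
    (x₀ x₁ x₂ x₃ x₄ : V) : A :=
  act x₀ (ω x₁ x₂ x₃ x₄) - act x₁ (ω x₀ x₂ x₃ x₄) + act x₂ (ω x₀ x₁ x₃ x₄)
    - act x₃ (ω x₀ x₁ x₂ x₄) + act x₄ (ω x₀ x₁ x₂ x₃)
    - ω (bk x₀ x₁) x₂ x₃ x₄ + ω (bk x₀ x₂) x₁ x₃ x₄ - ω (bk x₀ x₃) x₁ x₂ x₄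
    + ω (bk x₀ x₄) x₁ x₂ x₃
    - ω (bk x₁ x₂) x₀ x₃ x₄ + ω (bk x₁ x₃) x₀ x₂ x₄ - ω (bk x₁ x₄) x₀ x₂ x₃
    - ω (bk x₂ x₃) x₀ x₁ x₄ + ω (bk x₂ x₄) x₀ x₁ x₃
    - ω (bk x₃ x₄) x₀ x₁ x₂

end CE

section StandardCA

variable {A : Type} [CommRing A] [Algebra ℝ A]
variable (F : Submodule A (Derivation ℝ A A))
variable {G : Type} [AddCommGroup G] [Module A G] [Module ℝ G] [IsScalarTower ℝ A G]

/-- the leafwise Lie bracket on the integrable subbundle `F` -/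
def fbk (hF : ∀ x y : ↥F, ⁅(x : Derivation ℝ A A), (y : Derivation ℝ A A)⁆ ∈ F)
    (x y : ↥F) : ↥F :=
  ⟨⁅(x : Derivation ℝ A A), (y : Derivation ℝ A A)⁆, hF x y⟩

/-- the action of vector fields tangent to `F` on functions -/
def fact (x : ↥F) (f : A) : A := (x : Derivation ℝ A A) f

/-- A standard Courant algebroid structure on `F*⊕𝒢⊕F`: the anchor is the projection
onto `F`, the pseudo-metric is `½⟨ξ₁,x₂⟩ + ½⟨ξ₂,x₁⟩ + ⟨r₁,r₂⟩_𝒢`, and the 𝒢-component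
of the Dorfman bracket of sections of 𝒢 is the fiberwise bracket `[-,-]_𝒢`. -/
def IsStandardCA (lG : G → G → G) (ipG : G → G → A)
    (ca : CourantAlgebroid A (Module.Dual A ↥F × G × ↥F)) : Prop :=
  (∀ p, ca.rho p = ↑p.2.2) ∧
  (∀ p q, ca.ip p q =
    (2:ℝ)⁻¹ • p.1 q.2.2 + (2:ℝ)⁻¹ • q.1 p.2.2 + ipG p.2.1 q.2.1) ∧
  (∀ r s : G, (ca.dorf (0, r, 0) (0, s, 0)).2.1 = lG r s)

variable (ca : CourantAlgebroid A (Module.Dual A ↥F × G × ↥F))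

/-- the `F`-connection `∇` on `𝒢` induced by a standard Courant algebroid -/
def sNabla (x : ↥F) (r : G) : G := (ca.dorf (0, 0, x) (0, r, 0)).2.1

/-- the curvature-type bundle map `R : ∧²F → 𝒢` induced by a standard Courant algebroid -/
def sR (x y : ↥F) : G := (ca.dorf (0, 0, x) (0, 0, y)).2.1

/-- the 3-form `ℋ ∈ Γ(∧³F*)` induced by a standard Courant algebroid -/
def sH (x y z : ↥F) : A := (ca.dorf (0, 0, x) (0, 0, y)).1 z

/-- the 4-form `⟨R∧R⟩` on `F` -/
noncomputable def pontR (ipG : G → G → A) (Rm : ↥F → ↥F → G)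
    (x₁ x₂ x₃ x₄ : ↥F) : A :=
  (4:ℝ)⁻¹ • ∑ σ : Equiv.Perm (Fin 4),
    (Equiv.Perm.sign σ : ℤ) •
      ipG (Rm (![x₁, x₂, x₃, x₄] (σ 0)) (![x₁, x₂, x₃, x₄] (σ 1)))
          (Rm (![x₁, x₂, x₃, x₄] (σ 2)) (![x₁, x₂, x₃, x₄] (σ 3)))

end StandardCA

variable {A : Type} [CommRing A] [Algebra ℝ A]

/-- The Courant bracket (skew-symmetrization of the Dorfman bracket). -/
noncomputable def courantBk {E : Type} [AddCommGroup E] [Module A E] [Module ℝ E]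
    [IsScalarTower ℝ A E] (ca : CourantAlgebroid A E) (e₁ e₂ : E) : E :=
  (2:ℝ)⁻¹ • (ca.dorf e₁ e₂ - ca.dorf e₂ e₁)

section Diss

variable (F : Submodule A (Derivation ℝ A A))
variable {G : Type} [AddCommGroup G] [Module A G] [Module ℝ G] [IsScalarTower ℝ A G]
variable {E : Type} [AddCommGroup E] [Module A E] [Module ℝ E] [IsScalarTower ℝ A E]

/-- A dissection of a regular Courant algebroid with characteristic distribution `F`
and bundle of quadratic Lie algebras `𝒢`. -/
structure Dissection (lG : G → G → G) (ipG : G → G → A)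
    (ca : CourantAlgebroid A E) where
  toEquiv : (Module.Dual A ↥F × G × ↥F) ≃ₗ[A] E
  metric : ∀ p q, ca.ip (toEquiv p) (toEquiv q) =
    (2:ℝ)⁻¹ • p.1 q.2.2 + (2:ℝ)⁻¹ • q.1 p.2.2 + ipG p.2.1 q.2.1
  anchor : ∀ p, ca.rho (toEquiv p) = ↑p.2.2
  gbracket : ∀ r s : G,
    (toEquiv.symm (ca.dorf (toEquiv (0, r, 0)) (toEquiv (0, s, 0)))).2.1 = lG r s

variable {F} {lG : G → G → G} {ipG : G → G → A} {ca : CourantAlgebroid A E}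

/-- `R(x,y) = pr_𝒢(x∘y)` induced by a dissection. -/
def Dissection.Rmap (d : Dissection F lG ipG ca) (x y : ↥F) : G :=
  (d.toEquiv.symm (ca.dorf (d.toEquiv (0, 0, x)) (d.toEquiv (0, 0, y)))).2.1

/-- `ℋ(x,y,z) = ⟨pr_{F*}(x∘y),z⟩` induced by a dissection. -/
def Dissection.Hmap (d : Dissection F lG ipG ca) (x y z : ↥F) : A :=
  (d.toEquiv.symm (ca.dorf (d.toEquiv (0, 0, x)) (d.toEquiv (0, 0, y)))).1 z

/-- The naive 3-cocycle `C_Ψ` associated to a dissection `Ψ`. -/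
def Dissection.Cform (d : Dissection F lG ipG ca) (e₁ e₂ e₃ : E) : A :=
  ipG (d.Rmap (d.toEquiv.symm e₁).2.2 (d.toEquiv.symm e₂).2.2) (d.toEquiv.symm e₃).2.1
  + ipG (d.Rmap (d.toEquiv.symm e₂).2.2 (d.toEquiv.symm e₃).2.2) (d.toEquiv.symm e₁).2.1
  + ipG (d.Rmap (d.toEquiv.symm e₃).2.2 (d.toEquiv.symm e₁).2.2) (d.toEquiv.symm e₂).2.1
  - ipG (lG (d.toEquiv.symm e₁).2.1 (d.toEquiv.symm e₂).2.1) (d.toEquiv.symm e₃).2.1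
  + d.Hmap (d.toEquiv.symm e₁).2.2 (d.toEquiv.symm e₂).2.2 (d.toEquiv.symm e₃).2.2

end Diss

section Cs

variable (F : Submodule A (Derivation ℝ A A))
variable {G : Type} [AddCommGroup G] [Module A G] [Module ℝ G] [IsScalarTower ℝ A G]

/-- The standard 3-form `C^s` of `E^s`, viewed as a naive 3-cochain on `E^s` (i.e.
as the pullback under `q : E^s → 𝒜^s` of the standard coherent 3-form of `𝒜^s`). -/
def stdCsNaive (lG : G → G → G) (ipG : G → G → A)
    (ca : CourantAlgebroid A (Module.Dual A ↥F × G × ↥F))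
    (p q w : Module.Dual A ↥F × G × ↥F) : A :=
  sH F ca p.2.2 q.2.2 w.2.2 - ipG (lG p.2.1 q.2.1) w.2.1
    + ipG (sR F ca p.2.2 q.2.2) w.2.1 + ipG (sR F ca q.2.2 w.2.2) p.2.1
    + ipG (sR F ca w.2.2 p.2.2) q.2.1

end Cs

section StandardIdentities

lemma two_mul_algebraMap_half : (2 : A) * algebraMap ℝ A (2 : ℝ)⁻¹ = 1 := by
  rw [← map_ofNat (algebraMap ℝ A) 2, ← map_mul]
  simp

variable {E : Type} [AddCommGroup E] [Module A E] [Module ℝ E] [IsScalarTower ℝ A E]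

namespace CourantAlgebroid

variable (ca : CourantAlgebroid A E)

lemma ip_dorf_swap_right (a b c : E) :
    ca.ip (ca.dorf a b) c = ca.rho a (ca.ip b c) - ca.ip (ca.dorf a c) b := by
  rw [ca.rho_ip a b c, ca.ip_symm b (ca.dorf a c)]
  ring

lemma ip_dorf_swap_left (a b c : E) :
    ca.ip (ca.dorf a b) c = ca.rho c (ca.ip a b) - ca.ip (ca.dorf b a) c := by
  have h : ca.dorf a b = (2 : ℝ) • ca.Dmap (ca.ip a b) - ca.dorf b a := by
    rw [← ca.dorf_sym a b]; abel
  rw [h, ← ca.ip_D, two_smul, map_sub, map_add]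
  simp only [LinearMap.sub_apply, LinearMap.add_apply]
  ring

lemma Dmap_mem_perp (f : A) : ca.Dmap f ∈ ca.perp := by
  intro k hk
  have h1 := ca.ip_D f k
  rw [LinearMap.mem_ker.1 hk] at h1
  have h2 := two_mul_algebraMap_half (A := A)
  simp at h1
  linear_combination algebraMap ℝ A (2 : ℝ)⁻¹ * h1 - (ca.ip (ca.Dmap f) k) * h2

lemma courantBk_eq (a b : E) : courantBk ca a b = ca.dorf a b - ca.Dmap (ca.ip a b) := by
  have h : ca.dorf b a = (2 : ℝ) • ca.Dmap (ca.ip a b) - ca.dorf a b := by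
    rw [← ca.dorf_sym a b]; abel
  rw [courantBk, h]
  module

end CourantAlgebroid

variable {F : Submodule A (Derivation ℝ A A)}
variable {G : Type} [AddCommGroup G] [Module A G] [Module ℝ G] [IsScalarTower ℝ A G]

lemma fbk_swap (hF : ∀ x y : ↥F, ⁅(x : Derivation ℝ A A), (y : Derivation ℝ A A)⁆ ∈ F)
    (x y : ↥F) : fbk F hF x y = - fbk F hF y x := by
  apply Subtype.ext
  simp [fbk]

lemma fbk_zero_left (hF : ∀ x y : ↥F, ⁅(x : Derivation ℝ A A), (y : Derivation ℝ A A)⁆ ∈ F)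
    (y : ↥F) : fbk F hF 0 y = 0 := by
  apply Subtype.ext
  simp [fbk]

lemma fbk_zero_right (hF : ∀ x y : ↥F, ⁅(x : Derivation ℝ A A), (y : Derivation ℝ A A)⁆ ∈ F)
    (x : ↥F) : fbk F hF x 0 = 0 := by
  apply Subtype.ext
  simp [fbk]

namespace IsStandardCA

variable {lG : G → G → G} {ipG : G →ₗ[A] G →ₗ[A] A}
  {ca : CourantAlgebroid A (Module.Dual A ↥F × G × ↥F)}

lemma ip_eq (h : IsStandardCA F lG (fun r s => ipG r s) ca)
    (p q : Module.Dual A ↥F × G × ↥F) :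
    ca.ip p q =
      algebraMap ℝ A (2 : ℝ)⁻¹ * p.1 q.2.2 + algebraMap ℝ A (2 : ℝ)⁻¹ * q.1 p.2.2
        + ipG p.2.1 q.2.1 := by
  rw [h.2.1, Algebra.smul_def, Algebra.smul_def]

lemma dorf_snd_snd (h : IsStandardCA F lG (fun r s => ipG r s) ca)
    (hF : ∀ x y : ↥F, ⁅(x : Derivation ℝ A A), (y : Derivation ℝ A A)⁆ ∈ F)
    (p q : Module.Dual A ↥F × G × ↥F) :
    (ca.dorf p q).2.2 = fbk F hF p.2.2 q.2.2 := by
  apply Subtype.ext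
  rw [← h.1, ca.rho_dorf, h.1, h.1]
  rfl

lemma ip_dorf_form (h : IsStandardCA F lG (fun r s => ipG r s) ca)
    (hF : ∀ x y : ↥F, ⁅(x : Derivation ℝ A A), (y : Derivation ℝ A A)⁆ ∈ F)
    (p q : Module.Dual A ↥F × G × ↥F) (ξ : Module.Dual A ↥F) :
    ca.ip (ca.dorf p q) (ξ, 0, 0) = algebraMap ℝ A (2 : ℝ)⁻¹ * ξ (fbk F hF p.2.2 q.2.2) := by
  rw [h.ip_eq, h.dorf_snd_snd hF]
  simp

lemma ip_dorf_form_middle (h : IsStandardCA F lG (fun r s => ipG r s) ca)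
    (hF : ∀ x y : ↥F, ⁅(x : Derivation ℝ A A), (y : Derivation ℝ A A)⁆ ∈ F)
    (p q : Module.Dual A ↥F × G × ↥F) (ξ : Module.Dual A ↥F) :
    ca.ip (ca.dorf p (ξ, 0, 0)) q =
      algebraMap ℝ A (2 : ℝ)⁻¹ * ((p.2.2 : Derivation ℝ A A) (ξ q.2.2) - ξ (fbk F hF p.2.2 q.2.2)) := by
  rw [ca.ip_dorf_swap_right, h.ip_dorf_form hF, h.1, h.ip_eq]
  simp
  ring

lemma ip_dorf_form_left (h : IsStandardCA F lG (fun r s => ipG r s) ca)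
    (hF : ∀ x y : ↥F, ⁅(x : Derivation ℝ A A), (y : Derivation ℝ A A)⁆ ∈ F)
    (p q : Module.Dual A ↥F × G × ↥F) (ξ : Module.Dual A ↥F) :
    ca.ip (ca.dorf (ξ, 0, 0) p) q =
      algebraMap ℝ A (2 : ℝ)⁻¹ * ((q.2.2 : Derivation ℝ A A) (ξ p.2.2) - (p.2.2 : Derivation ℝ A A) (ξ q.2.2)
        + ξ (fbk F hF p.2.2 q.2.2)) := by
  rw [ca.ip_dorf_swap_left, h.ip_dorf_form_middle hF, h.1, h.ip_eq]
  simp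
  ring

lemma dual_separates (h : IsStandardCA F lG (fun r s => ipG r s) ca) (x : ↥F)
    (hx : ∀ ξ : Module.Dual A ↥F, ξ x = 0) : x = 0 := by
  have : ((0, 0, x) : Module.Dual A ↥F × G × ↥F) = 0 := by
    apply ca.ip_nondeg.1
    ext q <;> simp [h.ip_eq, hx]
  simpa using this

lemma components_eq_zero_of_mem_perp (h : IsStandardCA F lG (fun r s => ipG r s) ca)
    (ipG_nondeg : ∀ r, (∀ s, ipG r s = 0) → r = 0)
    {p : Module.Dual A ↥F × G × ↥F} (hp : p ∈ ca.perp) : p.2.1 = 0 ∧ p.2.2 = 0 := by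
  constructor
  · apply ipG_nondeg
    intro s
    have := hp (0, s, 0) (by simp [h.1])
    simpa [h.ip_eq] using this
  · apply h.dual_separates
    intro ξ
    have := hp (ξ, 0, 0) (by simp [h.1])
    rw [h.ip_eq] at this
    have h2 := two_mul_algebraMap_half (A := A)
    simp at this
    linear_combination 2 * this - (ξ p.2.2) * h2

end IsStandardCA

namespace Dissection

variable {lG : G → G → G} {ipG : G →ₗ[A] G →ₗ[A] A}
  {ca : CourantAlgebroid A (Module.Dual A ↥F × G × ↥F)}

lemma toEquiv_snd_snd (h : IsStandardCA F lG (fun r s => ipG r s) ca)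
    (d : Dissection F lG (fun r s => ipG r s) ca) (p : Module.Dual A ↥F × G × ↥F) :
    (d.toEquiv p).2.2 = p.2.2 := by
  apply Subtype.ext
  rw [← h.1, d.anchor]

lemma ip_toEquiv (d : Dissection F lG (fun r s => ipG r s) ca)
    (p q : Module.Dual A ↥F × G × ↥F) :
    ca.ip (d.toEquiv p) (d.toEquiv q) =
      algebraMap ℝ A (2 : ℝ)⁻¹ * p.1 q.2.2 + algebraMap ℝ A (2 : ℝ)⁻¹ * q.1 p.2.2
        + ipG p.2.1 q.2.1 := by
  rw [d.metric, Algebra.smul_def, Algebra.smul_def]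

lemma toEquiv_form (h : IsStandardCA F lG (fun r s => ipG r s) ca)
    (d : Dissection F lG (fun r s => ipG r s) ca) (ξ : Module.Dual A ↥F) :
    d.toEquiv (ξ, 0, 0) = (ξ, 0, 0) := by
  apply ca.ip_nondeg.1
  refine LinearMap.ext fun q' => ?_
  obtain ⟨q, rfl⟩ := d.toEquiv.surjective q'
  dsimp only
  rw [ip_toEquiv, h.ip_eq, d.toEquiv_snd_snd h]
  simp

/-- The `F*`-component of the splitting of the anchor given by a dissection. -/
def formPart (d : Dissection F lG (fun r s => ipG r s) ca) : ↥F →ₗ[A] Module.Dual A ↥F :=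
  LinearMap.fst A _ _ ∘ₗ d.toEquiv.toLinearMap ∘ₗ LinearMap.inr A _ _ ∘ₗ LinearMap.inr A _ _

/-- The `𝒢`-component of the splitting of the anchor given by a dissection. -/
def gPart (d : Dissection F lG (fun r s => ipG r s) ca) : ↥F →ₗ[A] G :=
  LinearMap.fst A _ _ ∘ₗ LinearMap.snd A _ _ ∘ₗ d.toEquiv.toLinearMap ∘ₗ LinearMap.inr A _ _ ∘ₗ
    LinearMap.inr A _ _

lemma toEquiv_vector (h : IsStandardCA F lG (fun r s => ipG r s) ca)
    (d : Dissection F lG (fun r s => ipG r s) ca) (x : ↥F) :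
    d.toEquiv (0, 0, x) = (0, 0, x) + (0, d.gPart x, 0) + (d.formPart x, 0, 0) := by
  refine Prod.ext ?_ (Prod.ext ?_ ?_)
  · simp [formPart]
  · simp [gPart]
  · simp [d.toEquiv_snd_snd h]

lemma formPart_add_formPart (h : IsStandardCA F lG (fun r s => ipG r s) ca)
    (d : Dissection F lG (fun r s => ipG r s) ca) (x y : ↥F) :
    algebraMap ℝ A (2 : ℝ)⁻¹ * d.formPart x y + algebraMap ℝ A (2 : ℝ)⁻¹ * d.formPart y x
      + ipG (d.gPart x) (d.gPart y) = 0 := by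
  have := d.ip_toEquiv (0, 0, x) (0, 0, y)
  rw [d.toEquiv_vector h, d.toEquiv_vector h, h.ip_eq] at this
  simpa using this

lemma toEquiv_fiber (h : IsStandardCA F lG (fun r s => ipG r s) ca)
    (d : Dissection F lG (fun r s => ipG r s) ca) (p : Module.Dual A ↥F × G × ↥F) :
    ∃ a : Module.Dual A ↥F,
      d.toEquiv (0, (d.toEquiv.symm p).2.1, 0) =
        (0, p.2.1, 0) - (0, d.gPart p.2.2, 0) + (a, 0, 0) ∧
      ∀ x, algebraMap ℝ A (2 : ℝ)⁻¹ * a x + ipG (p.2.1 - d.gPart p.2.2) (d.gPart x) = 0 := by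
  obtain ⟨q, rfl⟩ := d.toEquiv.surjective p
  rw [d.toEquiv.symm_apply_apply, d.toEquiv_snd_snd h]
  have hq : q = (q.1, 0, 0) + (0, q.2.1, 0) + (0, 0, q.2.2) := by simp
  have key : (d.toEquiv q).2.1 = (d.toEquiv (0, q.2.1, 0)).2.1 + d.gPart q.2.2 := by
    conv_lhs => rw [hq, map_add, map_add, d.toEquiv_form h]
    simp [gPart]
  have hg : d.toEquiv (0, q.2.1, 0) = (0, (d.toEquiv q).2.1, 0) - (0, d.gPart q.2.2, 0)
      + ((d.toEquiv (0, q.2.1, 0)).1, 0, 0) := by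
    refine Prod.ext ?_ (Prod.ext ?_ ?_)
    · simp
    · simp [key]
    · simp [d.toEquiv_snd_snd h]
  refine ⟨_, hg, fun x => ?_⟩
  have := d.ip_toEquiv (0, q.2.1, 0) (0, 0, x)
  rw [hg, d.toEquiv_vector h, h.ip_eq] at this
  simpa using this

lemma Hmap_eq (d : Dissection F lG (fun r s => ipG r s) ca) (x y z : ↥F) :
    d.Hmap x y z = 2 * ca.ip (ca.dorf (d.toEquiv (0, 0, x)) (d.toEquiv (0, 0, y)))
      (d.toEquiv (0, 0, z)) := by
  have := d.ip_toEquiv (d.toEquiv.symm (ca.dorf (d.toEquiv (0, 0, x)) (d.toEquiv (0, 0, y))))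
    (0, 0, z)
  rw [d.toEquiv.apply_symm_apply] at this
  rw [this, Hmap]
  have h2 := two_mul_algebraMap_half (A := A)
  simp only [LinearMap.zero_apply, map_zero]
  set H := (d.toEquiv.symm (ca.dorf (d.toEquiv (0, 0, x)) (d.toEquiv (0, 0, y)))).1 z
  linear_combination -H * h2

lemma ip_Rmap (d : Dissection F lG (fun r s => ipG r s) ca) (x y : ↥F) (t : G) :
    ipG (d.Rmap x y) t = ca.ip (ca.dorf (d.toEquiv (0, 0, x)) (d.toEquiv (0, 0, y)))
      (d.toEquiv (0, t, 0)) := by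
  have := d.ip_toEquiv (d.toEquiv.symm (ca.dorf (d.toEquiv (0, 0, x)) (d.toEquiv (0, 0, y))))
    (0, t, 0)
  rw [d.toEquiv.apply_symm_apply] at this
  rw [this, Rmap]
  simp

lemma ip_fiber_bracket (d : Dissection F lG (fun r s => ipG r s) ca) (r s t : G) :
    ipG (lG r s) t = ca.ip (ca.dorf (d.toEquiv (0, r, 0)) (d.toEquiv (0, s, 0)))
      (d.toEquiv (0, t, 0)) := by
  have := d.ip_toEquiv (d.toEquiv.symm (ca.dorf (d.toEquiv (0, r, 0)) (d.toEquiv (0, s, 0))))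
    (0, t, 0)
  rw [d.toEquiv.apply_symm_apply, d.gbracket] at this
  rw [this]
  simp

lemma Cform_eq (d : Dissection F lG (fun r s => ipG r s) ca)
    (p q w : Module.Dual A ↥F × G × ↥F) :
    d.Cform p q w =
      let Λ := fun u : Module.Dual A ↥F × G × ↥F => d.toEquiv (0, 0, (d.toEquiv.symm u).2.2)
      let g := fun u : Module.Dual A ↥F × G × ↥F => d.toEquiv (0, (d.toEquiv.symm u).2.1, 0)
      ca.ip (ca.dorf (Λ p) (Λ q)) (g w) + ca.ip (ca.dorf (Λ q) (Λ w)) (g p)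
        + ca.ip (ca.dorf (Λ w) (Λ p)) (g q) - ca.ip (ca.dorf (g p) (g q)) (g w)
        + 2 * ca.ip (ca.dorf (Λ p) (Λ q)) (Λ w) := by
  simp only [Cform, Hmap_eq, ip_Rmap, ip_fiber_bracket d]

/-- The standard Courant algebroid structure is dissected by the identity. -/
def refl (h : IsStandardCA F lG (fun r s => ipG r s) ca) :
    Dissection F lG (fun r s => ipG r s) ca where
  toEquiv := LinearEquiv.refl A _
  metric := h.2.1
  anchor := h.1
  gbracket := h.2.2

lemma stdCsNaive_eq (h : IsStandardCA F lG (fun r s => ipG r s) ca)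
    (p q w : Module.Dual A ↥F × G × ↥F) :
    stdCsNaive F lG (fun r s => ipG r s) ca p q w = (refl h).Cform p q w := by
  simp only [stdCsNaive, Cform, refl, Hmap, Rmap, sH, sR, LinearEquiv.refl_apply,
    LinearEquiv.refl_symm]
  ring

/-- The naive 2-cochain whose coboundary compares a dissection with the identity one. -/
def comparison (d : Dissection F lG (fun r s => ipG r s) ca)
    (p q : Module.Dual A ↥F × G × ↥F) : A :=
  ipG (d.gPart p.2.2) q.2.1 - ipG (d.gPart q.2.2) p.2.1 + d.formPart p.2.2 q.2.2
    + ipG (d.gPart p.2.2) (d.gPart q.2.2)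

lemma comparison_swap (ipG_symm : ∀ r s, ipG r s = ipG s r)
    (h : IsStandardCA F lG (fun r s => ipG r s) ca)
    (d : Dissection F lG (fun r s => ipG r s) ca) (p q : Module.Dual A ↥F × G × ↥F) :
    d.comparison p q = - d.comparison q p := by
  have h1 := d.formPart_add_formPart h p.2.2 q.2.2
  have h2 := two_mul_algebraMap_half (A := A)
  simp only [comparison]
  rw [ipG_symm (d.gPart q.2.2) (d.gPart p.2.2)]
  linear_combination 2 * h1 - (d.formPart p.2.2 q.2.2 + d.formPart q.2.2 p.2.2) * h2

lemma comparison_dorf (ipG_symm : ∀ r s, ipG r s = ipG s r)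
    (h : IsStandardCA F lG (fun r s => ipG r s) ca)
    (hF : ∀ x y : ↥F, ⁅(x : Derivation ℝ A A), (y : Derivation ℝ A A)⁆ ∈ F)
    (d : Dissection F lG (fun r s => ipG r s) ca) (p q w : Module.Dual A ↥F × G × ↥F) :
    d.comparison (ca.dorf p q) w =
      ipG (d.gPart (fbk F hF p.2.2 q.2.2)) (w.2.1 - d.gPart w.2.2)
        - ca.ip (ca.dorf p q) (0, d.gPart w.2.2, 0)
        - d.formPart w.2.2 (fbk F hF p.2.2 q.2.2) := by
  have h1 := d.formPart_add_formPart h (fbk F hF p.2.2 q.2.2) w.2.2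
  have h2 := two_mul_algebraMap_half (A := A)
  simp only [comparison, h.ip_eq, h.dorf_snd_snd hF]
  rw [ipG_symm _ (d.gPart w.2.2)]
  simp
  linear_combination 2 * h1 + ipG_symm (ca.dorf p q).2.1 (d.gPart w.2.2)
    - ipG_symm (d.gPart (fbk F hF p.2.2 q.2.2)) (d.gPart w.2.2) - (d.formPart (fbk F hF p.2.2 q.2.2) w.2.2
    + d.formPart w.2.2 (fbk F hF p.2.2 q.2.2)) * h2

set_option maxHeartbeats 1600000 in
/-- The coboundary identity, with all sections split into their components:
`jᵢ`, `bᵢ` are the components of the splitting at `xᵢ`, and `aᵢ` is the form part of the fiber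
component of the section with components `ξᵢ`, `rᵢ`, `xᵢ`. -/
lemma coboundary_identity (ipG_symm : ∀ r s, ipG r s = ipG s r)
    (h : IsStandardCA F lG (fun r s => ipG r s) ca)
    (hF : ∀ x y : ↥F, ⁅(x : Derivation ℝ A A), (y : Derivation ℝ A A)⁆ ∈ F)
    (x₀ x₁ x₂ : ↥F) (r₀ r₁ r₂ j₀ j₁ j₂ : G) (a₀ a₁ a₂ b₀ b₁ b₂ ξ₀ ξ₁ ξ₂ : Module.Dual A ↥F) :
    let T := fun p q w => ca.ip (ca.dorf p q) w
    let Λ := fun (x : ↥F) (j : G) (b : Module.Dual A ↥F) =>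
      ((0, 0, x) + (0, j, 0) + (b, 0, 0) : Module.Dual A ↥F × G × ↥F)
    let g := fun (r j : G) (a : Module.Dual A ↥F) =>
      ((0, r, 0) - (0, j, 0) + (a, 0, 0) : Module.Dual A ↥F × G × ↥F)
    let e := fun (ξ : Module.Dual A ↥F) (r : G) (x : ↥F) =>
      ((ξ, 0, 0) + (0, r, 0) + (0, 0, x) : Module.Dual A ↥F × G × ↥F)
    let f := fun x : ↥F => ((0, 0, x) : Module.Dual A ↥F × G × ↥F)
    let ι := fun r : G => ((0, r, 0) : Module.Dual A ↥F × G × ↥F)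
    let φ := fun (r j : G) (b : Module.Dual A ↥F) (y : ↥F) (s k : G) =>
      ipG j s - ipG k r + b y + ipG j k
    let ψ := fun (p q : Module.Dual A ↥F × G × ↥F) (j : G) (a b : Module.Dual A ↥F) =>
      - (algebraMap ℝ A (2 : ℝ)⁻¹ * a (fbk F hF p.2.2 q.2.2)) - T p q (ι j) - b (fbk F hF p.2.2 q.2.2)
    (T (Λ x₀ j₀ b₀) (Λ x₁ j₁ b₁) (g r₂ j₂ a₂) + T (Λ x₁ j₁ b₁) (Λ x₂ j₂ b₂) (g r₀ j₀ a₀)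
        + T (Λ x₂ j₂ b₂) (Λ x₀ j₀ b₀) (g r₁ j₁ a₁) - T (g r₀ j₀ a₀) (g r₁ j₁ a₁) (g r₂ j₂ a₂)
        + 2 * T (Λ x₀ j₀ b₀) (Λ x₁ j₁ b₁) (Λ x₂ j₂ b₂))
      - (T (f x₀) (f x₁) (ι r₂) + T (f x₁) (f x₂) (ι r₀) + T (f x₂) (f x₀) (ι r₁)
        - T (ι r₀) (ι r₁) (ι r₂) + 2 * T (f x₀) (f x₁) (f x₂))
      = (x₀ : Derivation ℝ A A) (φ r₁ j₁ b₁ x₂ r₂ j₂)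
        - (x₁ : Derivation ℝ A A) (φ r₀ j₀ b₀ x₂ r₂ j₂)
        + (x₂ : Derivation ℝ A A) (φ r₀ j₀ b₀ x₁ r₁ j₁)
        - ψ (e ξ₀ r₀ x₀) (e ξ₁ r₁ x₁) j₂ a₂ b₂ + ψ (e ξ₀ r₀ x₀) (e ξ₂ r₂ x₂) j₁ a₁ b₁
        - ψ (e ξ₁ r₁ x₁) (e ξ₂ r₂ x₂) j₀ a₀ b₀ := by
  have ggg_cycle : ∀ r s t : G, ca.ip (ca.dorf (0, r, 0) (0, s, 0)) (0, t, 0) =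
      ca.ip (ca.dorf (0, t, 0) (0, r, 0)) (0, s, 0) := by
    intro r s t
    rw [ca.ip_dorf_swap_right, ca.ip_dorf_swap_left _ (0, t, 0)]
    simp [h.1]
  have ggg_swap : ∀ r s t : G, ca.ip (ca.dorf (0, r, 0) (0, s, 0)) (0, t, 0) =
      - ca.ip (ca.dorf (0, r, 0) (0, t, 0)) (0, s, 0) := by
    intro r s t
    rw [ca.ip_dorf_swap_right]
    simp [h.1]
  have gvg : ∀ (r : G) (x : ↥F) (t : G), ca.ip (ca.dorf (0, r, 0) (0, 0, x)) (0, t, 0) =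
      - ca.ip (ca.dorf (0, 0, x) (0, r, 0)) (0, t, 0) := by
    intro r x t
    rw [ca.ip_dorf_swap_left]
    simp [h.1]
  have ggv : ∀ (r : G) (x : ↥F) (t : G), ca.ip (ca.dorf (0, r, 0) (0, t, 0)) (0, 0, x) =
      ca.ip (ca.dorf (0, 0, x) (0, r, 0)) (0, t, 0) := by
    intro r x t
    rw [ca.ip_dorf_swap_right, gvg]
    simp [h.1]
  have vgg : ∀ (x : ↥F) (r s : G), ca.ip (ca.dorf (0, 0, x) (0, r, 0)) (0, s, 0) =
      (x : Derivation ℝ A A) (ipG r s) - ca.ip (ca.dorf (0, 0, x) (0, s, 0)) (0, r, 0) := by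
    intro x r s
    rw [ca.ip_dorf_swap_right, h.ip_eq (0, r, 0) (0, s, 0), h.1]
    simp
  have vgv : ∀ (x y : ↥F) (r : G), ca.ip (ca.dorf (0, 0, x) (0, r, 0)) (0, 0, y) =
      - ca.ip (ca.dorf (0, 0, x) (0, 0, y)) (0, r, 0) := by
    intro x y r
    rw [ca.ip_dorf_swap_right, h.ip_eq (0, r, 0) (0, 0, y)]
    simp
  have vvg : ∀ (x y : ↥F) (r : G), ca.ip (ca.dorf (0, 0, x) (0, 0, y)) (0, r, 0) =
      - ca.ip (ca.dorf (0, 0, y) (0, 0, x)) (0, r, 0) := by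
    intro x y r
    rw [ca.ip_dorf_swap_left]
    simp [h.1]
  have gvv : ∀ (x y : ↥F) (r : G), ca.ip (ca.dorf (0, r, 0) (0, 0, x)) (0, 0, y) =
      ca.ip (ca.dorf (0, 0, x) (0, 0, y)) (0, r, 0) := by
    intro x y r
    rw [ca.ip_dorf_swap_left, vgv, h.ip_eq (0, r, 0) (0, 0, x)]
    simp
  have h2 := two_mul_algebraMap_half (A := A)
  intro T Λ g e f ι φ ψ
  simp only [T, Λ, g, e, f, ι, φ, ψ, map_add, map_sub, LinearMap.add_apply, LinearMap.sub_apply,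
    h.ip_dorf_form hF, h.ip_dorf_form_middle hF, h.ip_dorf_form_left hF, gvg, ggv, vgv, gvv,
    Prod.snd_add, add_zero, zero_add, sub_zero,
    fbk_zero_left, fbk_zero_right, map_zero, Submodule.coe_zero,
    Derivation.coe_zero, Pi.zero_apply, mul_zero]
  simp only [ggg_cycle r₁, ggg_cycle j₁]
  simp only [← ggg_cycle _ _ j₂]
  simp only [ggg_swap _ _ j₁]
  simp only [vvg x₂, fbk_swap hF x₂, vgg x₀ r₂, vgg x₀ j₂, vgg x₁ r₂, vgg x₁ j₂, vgg x₂ r₁, vgg x₂ j₁,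
    ipG_symm _ r₀, ipG_symm _ j₀, ipG_symm j₂ r₁, ipG_symm j₂ j₁, ipG_symm r₂ j₁,
    map_neg]
  linear_combination ((x₂ : Derivation ℝ A A) (b₀ x₁) - (x₁ : Derivation ℝ A A) (b₀ x₂)
    + b₀ (fbk F hF x₁ x₂) + (x₀ : Derivation ℝ A A) (b₁ x₂) - b₁ (fbk F hF x₀ x₂)
    + b₂ (fbk F hF x₀ x₁)) * h2

end Dissection

end StandardIdentities

open CourantAlgebroid in
/-- For a standard Courant algebroid `E^s` (determined by a quintuple
`(F,𝒢;∇,R,ℋ)`), the naive 3-cocycle of any dissection differs from the standard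
3-form `C^s` of the characteristic pair by a naive coboundary: the characteristic class
of `E^s` equals `[C^s] ∈ H³(𝒜^s)`. -/
theorem statement13
    {A : Type} [CommRing A] [Algebra ℝ A]
    (F : Submodule A (Derivation ℝ A A))
    (hF : ∀ x y : ↥F, ⁅(x : Derivation ℝ A A), (y : Derivation ℝ A A)⁆ ∈ F)
    {G : Type} [AddCommGroup G] [Module A G] [Module ℝ G] [IsScalarTower ℝ A G]
    -- 𝒢 is a bundle of quadratic Lie algebras
    (lG : G →ₗ[A] G →ₗ[A] G) (ipG : G →ₗ[A] G →ₗ[A] A)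
    (lG_skew : ∀ r s, lG r s = - lG s r)
    (lG_jacobi : ∀ r s t, lG r (lG s t) = lG (lG r s) t + lG s (lG r t))
    (ipG_symm : ∀ r s, ipG r s = ipG s r)
    (ipG_nondeg : ∀ r, (∀ s, ipG r s = 0) → r = 0)
    (ipG_ad : ∀ r s t, ipG (lG r s) t + ipG s (lG r t) = 0)
    -- the standard Courant algebroid E^s
    (ca : CourantAlgebroid A (Module.Dual A ↥F × G × ↥F))
    (hstd : IsStandardCA F (fun r s => lG r s) (fun r s => ipG r s) ca)
    -- any dissection Ψ of E^s
    (d : Dissection F (fun r s => lG r s) (fun r s => ipG r s) ca) :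
    ∃ φ : (Module.Dual A ↥F × G × ↥F) → (Module.Dual A ↥F × G × ↥F) → A,
      -- φ is a naive 2-cochain: alternating, C^∞(M)-bilinear, a section of ∧²ker ρ
      (∀ e₁ e₂, φ e₁ e₂ = - φ e₂ e₁) ∧
      (∀ (f : A) e₁ e₁' e₂, φ (f • e₁ + e₁') e₂ = f * φ e₁ e₂ + φ e₁' e₂) ∧
      (∀ e₁ e₂, e₁ ∈ ca.perp → φ e₁ e₂ = 0) ∧
      -- C_Ψ − C^s = d̆φ
      (∀ e₀ e₁ e₂,
        d.Cform e₀ e₁ e₂ - stdCsNaive F (fun r s => lG r s) (fun r s => ipG r s) ca e₀ e₁ e₂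
          = dCE2 (fun e f => ca.rho e f) (courantBk ca) φ e₀ e₁ e₂) := by
  refine ⟨d.comparison, d.comparison_swap ipG_symm hstd, ?_, ?_, ?_⟩
  · intro f p p' q
    simp [Dissection.comparison]
    ring
  · intro p q hp
    obtain ⟨h1, h2⟩ := hstd.components_eq_zero_of_mem_perp ipG_nondeg hp
    simp [Dissection.comparison, h1, h2]
  · intro p q w
    have bracket : ∀ u v z, d.comparison (courantBk ca u v) z =
        d.comparison (ca.dorf u v) z := by
      intro u v z
      obtain ⟨h1, h2⟩ := hstd.components_eq_zero_of_mem_perp ipG_nondeg (ca.Dmap_mem_perp (ca.ip u v))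
      simp [ca.courantBk_eq, Dissection.comparison, h1, h2]
    obtain ⟨a₀, hg₀, ha₀⟩ := d.toEquiv_fiber hstd p
    obtain ⟨a₁, hg₁, ha₁⟩ := d.toEquiv_fiber hstd q
    obtain ⟨a₂, hg₂, ha₂⟩ := d.toEquiv_fiber hstd w
    have hx : ∀ u, (d.toEquiv.symm u).2.2 = u.2.2 := by
      intro u
      rw [← d.toEquiv_snd_snd hstd, d.toEquiv.apply_symm_apply]
    have key := Dissection.coboundary_identity ipG_symm hstd hF p.2.2 q.2.2 w.2.2
      p.2.1 q.2.1 w.2.1 (d.gPart p.2.2) (d.gPart q.2.2) (d.gPart w.2.2) a₀ a₁ a₂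
      (d.formPart p.2.2) (d.formPart q.2.2) (d.formPart w.2.2) p.1 q.1 w.1
    have decomp : ∀ u : Module.Dual A ↥F × G × ↥F,
        (u.1, 0, 0) + (0, u.2.1, 0) + (0, 0, u.2.2) = u := by
      intro u
      simp
    have fiber : ∀ (a : Module.Dual A ↥F) (u : Module.Dual A ↥F × G × ↥F) (n : ↥F),
        (∀ x, algebraMap ℝ A (2 : ℝ)⁻¹ * a x
          + ipG (u.2.1 - d.gPart u.2.2) (d.gPart x) = 0) →
        - (algebraMap ℝ A (2 : ℝ)⁻¹ * a n) = ipG (d.gPart n) (u.2.1 - d.gPart u.2.2) := by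
      intro a u n ha
      rw [ipG_symm]
      linear_combination - ha n
    dsimp only at key
    simp only [decomp, fiber a₀ p _ ha₀, fiber a₁ q _ ha₁, fiber a₂ w _ ha₂] at key
    rw [Dissection.stdCsNaive_eq hstd, Dissection.Cform_eq, Dissection.Cform_eq, dCE2]
    simp only [bracket, Dissection.comparison_dorf ipG_symm hstd hF, hg₀, hg₁, hg₂, hx,
      d.toEquiv_vector hstd, hstd.1]
    exact key
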